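/- If K is a monoidal triangulated category in which every object is either left or right dualizable, and K has objects A and B such that A ⊗ B ≅ 0 but B ⊗ A ≇ 0, then not all prime ideals of K are completely prime. -/

import Mathlib

open CategoryTheory CategoryTheory.Limits CategoryTheory.Pretriangulated
open CategoryTheory.MonoidalCategory

universe w v u

variable (C : Type u) [Category.{v} C] [MonoidalCategory C] [Preadditive C]
  [HasZeroObject C] [HasBinaryBiproducts C] [HasShift C ℤ]
  [∀ n : ℤ, (shiftFunctor C n).Additive] [Pretriangulated C]

structure ThickSubcat where
  carrier : Set C
  zero_mem : ∀ A : C, IsZero A → A ∈ carrier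
  iso_closed : ∀ {A B : C}, (A ≅ B) → A ∈ carrier → B ∈ carrier
  shift_closed : ∀ (A : C) (n : ℤ), A ∈ carrier → A⟦n⟧ ∈ carrier
  triangle_closed : ∀ T ∈ distTriang C,
    Triangle.obj₁ T ∈ carrier → Triangle.obj₂ T ∈ carrier → Triangle.obj₃ T ∈ carrier
  summand_closed : ∀ A B : C, (A ⊞ B) ∈ carrier → A ∈ carrier

structure ThickRightIdeal extends ThickSubcat C where
  tensor_right : ∀ A ∈ carrier, ∀ B : C, A ⊗ B ∈ carrier

structure ThickIdeal extends ThickRightIdeal C where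
  tensor_left : ∀ A ∈ carrier, ∀ B : C, B ⊗ A ∈ carrier

variable {C}

def ThickIdeal.IsProper (P : ThickIdeal C) : Prop := P.carrier ≠ Set.univ

def ThickIdeal.IsPrime (P : ThickIdeal C) : Prop :=
  P.IsProper ∧ ∀ I J : ThickIdeal C,
    (∀ A ∈ I.carrier, ∀ B ∈ J.carrier, A ⊗ B ∈ P.carrier) →
    I.carrier ⊆ P.carrier ∨ J.carrier ⊆ P.carrier

def ThickIdeal.IsCompletelyPrime (P : ThickIdeal C) : Prop :=
  P.IsProper ∧ ∀ A B : C, A ⊗ B ∈ P.carrier → A ∈ P.carrier ∨ B ∈ P.carrier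

def ThickIdeal.IsSemiprime (Q : ThickIdeal C) : Prop :=
  ∃ S : Set (ThickIdeal C), (∀ P ∈ S, P.IsPrime) ∧ Q.carrier = ⋂ P ∈ S, P.carrier

variable (C)

/-- The thick two-sided ideal generated by a set of objects. -/
def genIdeal (S : Set C) : ThickIdeal C where
  carrier := {A : C | ∀ I : ThickIdeal C, S ⊆ I.carrier → A ∈ I.carrier}
  zero_mem := fun A hA I _ => I.zero_mem A hA
  iso_closed := fun {A B} e hA I hI => I.iso_closed e (hA I hI)
  shift_closed := fun A n hA I hI => I.shift_closed A n (hA I hI)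
  triangle_closed := fun T hT h1 h2 I hI =>
    I.triangle_closed T hT (h1 I hI) (h2 I hI)
  summand_closed := fun A B hAB I hI => I.summand_closed A B (hAB I hI)
  tensor_right := fun A hA B I hI => I.tensor_right A (hA I hI) B
  tensor_left := fun A hA B I hI => I.tensor_left A (hA I hI) B

/-- The thick right ideal generated by a set of objects. -/
def genRightIdeal (S : Set C) : ThickRightIdeal C where
  carrier := {A : C | ∀ I : ThickRightIdeal C, S ⊆ I.carrier → A ∈ I.carrier}
  zero_mem := fun A hA I _ => I.zero_mem A hA
  iso_closed := fun {A B} e hA I hI => I.iso_closed e (hA I hI)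
  shift_closed := fun A n hA I hI => I.shift_closed A n (hA I hI)
  triangle_closed := fun T hT h1 h2 I hI =>
    I.triangle_closed T hT (h1 I hI) (h2 I hI)
  summand_closed := fun A B hAB I hI => I.summand_closed A B (hAB I hI)
  tensor_right := fun A hA B I hI => I.tensor_right A (hA I hI) B

/-- The set of tensor products of objects from `I` and from `J`. -/
def tensorSet (I J : ThickIdeal C) : Set C :=
  {X : C | ∃ A ∈ I.carrier, ∃ B ∈ J.carrier, X = A ⊗ B}

/-- `Φ_σ(S) = ⋃_{A ∈ S} σ(A)`. -/
def Phi {Y : Type w} (s : C → Set Y) (S : Set C) : Set Y := ⋃ A ∈ S, s A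

/-- A support datum with values in subsets of a space `Y`. -/
structure SupportDatum (Y : Type w) where
  s : C → Set Y
  zero : ∀ A : C, IsZero A → s A = ∅
  unit : s (𝟙_ C) = Set.univ
  sum : ∀ A B : C, s (A ⊞ B) = s A ∪ s B
  shift : ∀ A : C, s (A⟦(1 : ℤ)⟧) = s A
  triangle : ∀ T ∈ distTriang C,
    s (Triangle.obj₁ T) ⊆ s (Triangle.obj₂ T) ∪ s (Triangle.obj₃ T)
  tensor : ∀ A B : C, (⋃ X : C, s (A ⊗ X ⊗ B)) = s A ∩ s B

/-- A weak support datum with values in subsets of a space `Y`. -/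
structure WeakSupportDatum (Y : Type w) where
  s : C → Set Y
  zero : ∀ A : C, IsZero A → s A = ∅
  unit : s (𝟙_ C) = Set.univ
  sum : ∀ A B : C, s (A ⊞ B) = s A ∪ s B
  shift : ∀ A : C, s (A⟦(1 : ℤ)⟧) = s A
  triangle : ∀ T ∈ distTriang C,
    s (Triangle.obj₁ T) ⊆ s (Triangle.obj₂ T) ∪ s (Triangle.obj₃ T)
  tensorIdeal : ∀ I J : ThickIdeal C,
    Phi C s (genIdeal C (tensorSet C I J)).carrier =
      Phi C s I.carrier ∩ Phi C s J.carrier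

/-- `n`-th tensor power of an object. -/
def tpow (M : C) : ℕ → C
  | 0 => 𝟙_ C
  | n + 1 => tpow M n ⊗ M

def Spc := {P : ThickIdeal C // P.IsPrime}

def suppV (M : C) : Set (Spc C) := {P : Spc C | M ∉ P.1.carrier}

instance : TopologicalSpace (Spc C) :=
  TopologicalSpace.generateFrom {U : Set (Spc C) | ∃ M : C, U = (suppV C M)ᶜ}

def CPSpc := {P : ThickIdeal C // P.IsCompletelyPrime}

def suppVCP (M : C) : Set (CPSpc C) := {P : CPSpc C | M ∉ P.1.carrier}

section

set_option linter.unusedSectionVars false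

variable {C}

namespace ThickSubcat

variable (Q : ThickSubcat C)

lemma mem_of_retract {X Y : C} (i : X ⟶ Y) (r : Y ⟶ X) (h : i ≫ r = 𝟙 X)
    (hY : Y ∈ Q.carrier) : X ∈ Q.carrier := by
  obtain ⟨Z, p, q, hT⟩ := distinguished_cocone_triangle i
  have : Mono i := (SplitMono.mk r h).mono
  have hq : q = 0 := Triangle.mor₃_eq_zero_of_mono₁ _ hT this
  obtain ⟨e, -, -⟩ := exists_iso_binaryBiproduct_of_distTriang _ hT hq
  exact Q.summand_closed X Z (Q.iso_closed e hY)

lemma mem_obj₁ {T : Triangle C} (hT : T ∈ distTriang C) (h₂ : T.obj₂ ∈ Q.carrier)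
    (h₃ : T.obj₃ ∈ Q.carrier) : T.obj₁ ∈ Q.carrier :=
  Q.iso_closed ((shiftEquiv C (1 : ℤ)).unitIso.app T.obj₁).symm
    (Q.shift_closed _ (-1) (Q.triangle_closed _ (rot_of_distTriang _ hT) h₂ h₃))

lemma biprod_mem {X Y : C} (hX : X ∈ Q.carrier) (hY : Y ∈ Q.carrier) :
    (X ⊞ Y) ∈ Q.carrier :=
  Q.triangle_closed _ (inv_rot_of_distTriang _ (binaryBiproductTriangle_distinguished X Y))
    (Q.shift_closed _ (-1) hY) hX

end ThickSubcat

lemma CategoryTheory.Adjunction.exists_lift_of_distTriang {L R : C ⥤ C} (adj : L ⊣ R)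
    {T : Triangle C} (hT : T ∈ distTriang C) {W : C} (w : W ⟶ R.obj T.obj₂)
    (hw : w ≫ R.map T.mor₂ = 0) : ∃ u : W ⟶ R.obj T.obj₁, w = u ≫ R.map T.mor₁ := by
  have := adj.isLeftAdjoint
  obtain ⟨u, hu⟩ := T.coyoneda_exact₂ hT ((adj.homEquiv _ _).symm w) (by
    rw [← adj.homEquiv_naturality_right_symm, hw, adj.homEquiv_counit, Functor.map_zero, zero_comp])
  refine ⟨adj.homEquiv _ _ u, ?_⟩
  rw [← adj.homEquiv_naturality_right, ← hu, Equiv.apply_symm_apply]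

lemma CategoryTheory.Adjunction.exists_desc_of_distTriang {L R : C ⥤ C} (adj : L ⊣ R)
    {T : Triangle C} (hT : T ∈ distTriang C) {W : C} (w : L.obj T.obj₂ ⟶ W)
    (hw : L.map T.mor₁ ≫ w = 0) : ∃ u : L.obj T.obj₃ ⟶ W, w = L.map T.mor₂ ≫ u := by
  have := adj.isRightAdjoint
  obtain ⟨u, hu⟩ := T.yoneda_exact₂ hT (adj.homEquiv _ _ w) (by
    rw [← adj.homEquiv_naturality_left, hw, adj.homEquiv_unit, Functor.map_zero, comp_zero])
  refine ⟨(adj.homEquiv _ _).symm u, ?_⟩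
  rw [← adj.homEquiv_naturality_left_symm, ← hu, Equiv.symm_apply_apply]

namespace ThickSubcat

variable (Q : ThickSubcat C)

/-- A right adjoint need not commute with shifts, but it sends the third vertex of a distinguished
triangle to a direct summand of an extension of the images of the other vertices. -/
lemma obj₃_mem_of_isRightAdjoint (R : C ⥤ C) [R.IsRightAdjoint] {T : Triangle C}
    (hT : T ∈ distTriang C) (h₁ : R.obj T.obj₁ ∈ Q.carrier) (h₂ : R.obj T.obj₂ ∈ Q.carrier)
    (h₁' : R.obj (T.obj₁⟦(1 : ℤ)⟧) ∈ Q.carrier) : R.obj T.obj₃ ∈ Q.carrier := by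
  have adj := Adjunction.ofIsRightAdjoint R
  obtain ⟨U, p, q, hU⟩ := distinguished_cocone_triangle (R.map T.mor₁)
  have hfp : R.map T.mor₁ ≫ p = 0 := comp_distTriang_mor_zero₁₂ _ hU
  obtain ⟨V, v, q', hV⟩ := distinguished_cocone_triangle₁ (R.map T.mor₂)
  obtain ⟨t, ht⟩ := adj.exists_lift_of_distTriang hT v (comp_distTriang_mor_zero₁₂ _ hV)
  have hvp : v ≫ p = 0 := by rw [ht, Category.assoc, hfp, comp_zero]
  obtain ⟨a, ha⟩ : ∃ a : R.obj T.obj₃ ⟶ U, p = R.map T.mor₂ ≫ a :=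
    Triangle.yoneda_exact₂ _ hV p hvp
  have : Mono (biprod.lift a (R.map T.mor₃)) := by
    refine Preadditive.mono_of_cancel_zero _ fun {W} w hw => ?_
    have h1 : w ≫ a = 0 := by simpa using hw =≫ biprod.fst
    have h2 : w ≫ R.map T.mor₃ = 0 := by simpa using hw =≫ biprod.snd
    obtain ⟨u, rfl⟩ : ∃ u, w = u ≫ R.map T.mor₂ :=
      adj.exists_lift_of_distTriang (rot_of_distTriang _ hT) w h2
    rw [Category.assoc, ← ha] at h1
    obtain ⟨s, rfl⟩ : ∃ s, u = s ≫ R.map T.mor₁ := Triangle.coyoneda_exact₂ _ hU u h1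
    rw [Category.assoc, ← R.map_comp, comp_distTriang_mor_zero₁₂ _ hT, R.map_zero, comp_zero]
  have := isSplitMono_of_mono (biprod.lift a (R.map T.mor₃))
  exact Q.mem_of_retract _ (retraction (biprod.lift a (R.map T.mor₃))) (IsSplitMono.id _)
    (Q.biprod_mem (Q.triangle_closed _ hU h₁ h₂) h₁')

/-- A left adjoint need not commute with shifts, but it sends the first vertex of a distinguished
triangle to a direct summand of an extension of the images of the other vertices. -/
lemma obj₁_mem_of_isLeftAdjoint (L : C ⥤ C) [L.IsLeftAdjoint] {T : Triangle C}
    (hT : T ∈ distTriang C) (h₂ : L.obj T.obj₂ ∈ Q.carrier) (h₃ : L.obj T.obj₃ ∈ Q.carrier)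
    (h₃' : L.obj (T.obj₃⟦(-1 : ℤ)⟧) ∈ Q.carrier) : L.obj T.obj₁ ∈ Q.carrier := by
  have adj := Adjunction.ofIsLeftAdjoint L
  obtain ⟨U, i, q, hU⟩ := distinguished_cocone_triangle₁ (L.map T.mor₂)
  have hig : i ≫ L.map T.mor₂ = 0 := comp_distTriang_mor_zero₁₂ _ hU
  obtain ⟨V, v, q', hV⟩ := distinguished_cocone_triangle (L.map T.mor₁)
  obtain ⟨t, ht⟩ := adj.exists_desc_of_distTriang hT v (comp_distTriang_mor_zero₁₂ _ hV)
  have hiv : i ≫ v = 0 := by rw [ht, ← Category.assoc, hig, zero_comp]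
  obtain ⟨a, ha⟩ : ∃ a : U ⟶ L.obj T.obj₁, i = a ≫ L.map T.mor₁ :=
    Triangle.coyoneda_exact₂ _ hV i hiv
  let k : T.obj₃⟦(-1 : ℤ)⟧ ⟶ T.obj₁ := T.invRotate.mor₁
  have : Epi (biprod.desc a (L.map k)) := by
    refine Preadditive.epi_of_cancel_zero _ fun {W} w hw => ?_
    have h1 : a ≫ w = 0 := by simpa using biprod.inl ≫= hw
    have h2 : L.map k ≫ w = 0 := by simpa using biprod.inr ≫= hw
    obtain ⟨u, rfl⟩ : ∃ u, w = L.map T.mor₁ ≫ u :=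
      adj.exists_desc_of_distTriang (inv_rot_of_distTriang _ hT) w h2
    rw [← Category.assoc, ← ha] at h1
    obtain ⟨s, rfl⟩ : ∃ s, u = L.map T.mor₂ ≫ s := Triangle.yoneda_exact₂ _ hU u h1
    rw [← Category.assoc, ← L.map_comp, comp_distTriang_mor_zero₁₂ _ hT, L.map_zero, zero_comp]
  have := isSplitEpi_of_epi (biprod.desc a (L.map k))
  exact Q.mem_of_retract (section_ (biprod.desc a (L.map k))) _ (IsSplitEpi.id _)
    (Q.biprod_mem (Q.mem_obj₁ hU h₂ h₃) h₃')

/-- The objects all of whose shifts are sent into `Q` by an endofunctor admitting an adjoint. -/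
def comap (F : C ⥤ C) (hF : F.IsLeftAdjoint ∨ F.IsRightAdjoint) : ThickSubcat C where
  carrier := {X | ∀ n : ℤ, F.obj (X⟦n⟧) ∈ Q.carrier}
  zero_mem X hX n := by
    have : F.PreservesZeroMorphisms := by
      rcases hF with h | h <;> infer_instance
    exact Q.zero_mem _ (F.map_isZero ((shiftFunctor C n).map_isZero hX))
  iso_closed e h n := Q.iso_closed (F.mapIso ((shiftFunctor C n).mapIso e)) (h n)
  shift_closed X m h n :=
    Q.iso_closed (F.mapIso ((shiftFunctorAdd C m n).app X)) (h (m + n))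
  triangle_closed T hT h₁ h₂ n := by
    have hTn := Triangle.shift_distinguished T hT n
    have shift (X : C) (h : ∀ n : ℤ, F.obj (X⟦n⟧) ∈ Q.carrier) (m k : ℤ) :
        F.obj (X⟦m⟧⟦k⟧) ∈ Q.carrier :=
      Q.iso_closed (F.mapIso ((shiftFunctorAdd C m k).app X)) (h (m + k))
    rcases hF with hF | hF
    · refine Q.obj₁_mem_of_isLeftAdjoint F
        (rot_of_distTriang _ (rot_of_distTriang _ hTn)) (shift _ h₁ n 1) (shift _ h₂ n 1) ?_
      exact Q.iso_closed (F.mapIso ((shiftEquiv C (1 : ℤ)).unitIso.app (T.obj₂⟦n⟧))) (h₂ n)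
    · exact Q.obj₃_mem_of_isRightAdjoint F hTn (h₁ n) (h₂ n) (shift _ h₁ n 1)
  summand_closed X Y h n := by
    refine Q.mem_of_retract (F.map ((biprod.inl : X ⟶ X ⊞ Y)⟦n⟧'))
      (F.map ((biprod.fst : X ⊞ Y ⟶ X)⟦n⟧')) ?_ (h n)
    rw [← F.map_comp, ← Functor.map_comp, biprod.inl_fst, CategoryTheory.Functor.map_id, F.map_id]

variable {Q} in
lemma obj_mem_of_mem_comap {F : C ⥤ C} {hF : F.IsLeftAdjoint ∨ F.IsRightAdjoint} {X : C}
    (h : X ∈ (Q.comap F hF).carrier) : F.obj X ∈ Q.carrier :=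
  Q.iso_closed (F.mapIso ((shiftFunctorZero C ℤ).app X)) (h 0)

variable (C) in
/-- The thick subcategory generated by a set of objects. -/
def closure (S : Set C) : ThickSubcat C where
  carrier := {A | ∀ Q : ThickSubcat C, S ⊆ Q.carrier → A ∈ Q.carrier}
  zero_mem _ hA Q _ := Q.zero_mem _ hA
  iso_closed e hA Q hQ := Q.iso_closed e (hA Q hQ)
  shift_closed A n hA Q hQ := Q.shift_closed A n (hA Q hQ)
  triangle_closed T hT h₁ h₂ Q hQ := Q.triangle_closed T hT (h₁ Q hQ) (h₂ Q hQ)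
  summand_closed A B h Q hQ := Q.summand_closed A B (h Q hQ)

lemma subset_closure (S : Set C) : S ⊆ (closure C S).carrier := fun _ hA _ hQ => hQ hA

lemma obj_mem_of_mem_closure {S : Set C} (F : C ⥤ C)
    (hF : F.IsLeftAdjoint ∨ F.IsRightAdjoint) (hS : ∀ X ∈ S, ∀ n : ℤ, F.obj (X⟦n⟧) ∈ Q.carrier)
    {X : C} (hX : X ∈ (closure C S).carrier) : F.obj X ∈ Q.carrier :=
  obj_mem_of_mem_comap (hX (Q.comap F hF) hS)

end ThickSubcat

section Dualizable

variable (hdual : ∀ A : C,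
  (∃ B : C, Nonempty (ExactPairing A B)) ∨ (∃ B : C, Nonempty (ExactPairing B A)))

include hdual

lemma tensorLeft_isLeftAdjoint_or_isRightAdjoint (A : C) :
    (tensorLeft A).IsLeftAdjoint ∨ (tensorLeft A).IsRightAdjoint := by
  rcases hdual A with ⟨B, ⟨_⟩⟩ | ⟨B, ⟨_⟩⟩
  · exact Or.inr (tensorLeftAdjunction A B).isRightAdjoint
  · exact Or.inl (tensorLeftAdjunction B A).isLeftAdjoint

lemma tensorRight_isLeftAdjoint_or_isRightAdjoint (A : C) :
    (tensorRight A).IsLeftAdjoint ∨ (tensorRight A).IsRightAdjoint := by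
  rcases hdual A with ⟨B, ⟨_⟩⟩ | ⟨B, ⟨_⟩⟩
  · exact Or.inl (tensorRightAdjunction A B).isLeftAdjoint
  · exact Or.inr (tensorRightAdjunction B A).isRightAdjoint

/-- Every object `A` is a retract of `A ⊗ A* ⊗ A`. -/
lemma exists_retract_tensor (A : C) :
    ∃ (B : C) (i : A ⟶ A ⊗ B ⊗ A) (r : A ⊗ B ⊗ A ⟶ A), i ≫ r = 𝟙 A := by
  rcases hdual A with ⟨B, ⟨_⟩⟩ | ⟨B, ⟨_⟩⟩
  · refine ⟨B, (λ_ A).inv ≫ η_ A B ▷ A ≫ (α_ _ _ _).hom, A ◁ ε_ A B ≫ (ρ_ A).hom, ?_⟩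
    have := ExactPairing.evaluation_coevaluation A B
    simp only [Category.assoc, reassoc_of% this]
    simp
  · refine ⟨B, (ρ_ A).inv ≫ A ◁ η_ B A, (α_ _ _ _).inv ≫ ε_ B A ▷ A ≫ (λ_ A).hom, ?_⟩
    have := ExactPairing.coevaluation_evaluation B A
    simp only [Category.assoc, reassoc_of% this]
    simp

/-- The thick ideal of zero objects. -/
def ThickIdeal.bot : ThickIdeal C where
  carrier := {A | IsZero A}
  zero_mem _ hA := hA
  iso_closed e hA := hA.of_iso e.symm
  shift_closed _ n hA := (shiftFunctor C n).map_isZero hA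
  triangle_closed T hT h₁ h₂ := T.isZero₃_of_isZero₁₂ hT h₁ h₂
  summand_closed A B h :=
    h.of_mono (biprod.inl : A ⟶ A ⊞ B)
  tensor_right A hA B := by
    have : (tensorRight B).PreservesZeroMorphisms := by
      rcases tensorRight_isLeftAdjoint_or_isRightAdjoint hdual B with h | h <;> infer_instance
    exact (tensorRight B).map_isZero hA
  tensor_left A hA B := by
    have : (tensorLeft B).PreservesZeroMorphisms := by
      rcases tensorLeft_isLeftAdjoint_or_isRightAdjoint hdual B with h | h <;> infer_instance
    exact (tensorLeft B).map_isZero hA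

/-- The thick ideal generated by two thick ideals. -/
def ThickIdeal.sup (I J : ThickIdeal C) : ThickIdeal C where
  toThickSubcat := ThickSubcat.closure C (I.carrier ∪ J.carrier)
  tensor_right _ hA B :=
    ThickSubcat.obj_mem_of_mem_closure _ (tensorRight B)
      (tensorRight_isLeftAdjoint_or_isRightAdjoint hdual B)
      (fun _ hX n => ThickSubcat.subset_closure _ (hX.imp
        (fun h => I.tensor_right _ (I.shift_closed _ n h) B)
        (fun h => J.tensor_right _ (J.shift_closed _ n h) B))) hA
  tensor_left _ hA B :=
    ThickSubcat.obj_mem_of_mem_closure _ (tensorLeft B)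
      (tensorLeft_isLeftAdjoint_or_isRightAdjoint hdual B)
      (fun _ hX n => ThickSubcat.subset_closure _ (hX.imp
        (fun h => I.tensor_left _ (I.shift_closed _ n h) B)
        (fun h => J.tensor_left _ (J.shift_closed _ n h) B))) hA

lemma ThickIdeal.tensor_mem_of_mem_sup {P I J : ThickIdeal C}
    (h : ∀ A ∈ I.carrier, ∀ B ∈ J.carrier, A ⊗ B ∈ P.carrier) {X Y : C}
    (hX : X ∈ (ThickIdeal.sup hdual P I).carrier) (hY : Y ∈ (ThickIdeal.sup hdual P J).carrier) :
    X ⊗ Y ∈ P.carrier := by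
  refine ThickSubcat.obj_mem_of_mem_closure P.toThickSubcat (tensorRight Y)
    (tensorRight_isLeftAdjoint_or_isRightAdjoint hdual Y) ?_ hX
  rintro X (hX | hX) n
  · exact P.tensor_right _ (P.shift_closed _ n hX) Y
  · refine ThickSubcat.obj_mem_of_mem_closure P.toThickSubcat (tensorLeft (X⟦n⟧))
      (tensorLeft_isLeftAdjoint_or_isRightAdjoint hdual _) ?_ hY
    rintro Y (hY | hY) m
    · exact P.tensor_left _ (P.shift_closed _ m hY) _
    · exact h _ (I.shift_closed _ n hX) _ (J.shift_closed _ m hY)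

/-- Every nonzero object is avoided by some prime ideal. -/
lemma exists_isPrime_notMem {M : C} (hM : ¬ IsZero M) :
    ∃ P : ThickIdeal C, P.IsPrime ∧ M ∉ P.carrier := by
  obtain ⟨_, -, ⟨P, rfl, hMP⟩, hmax⟩ := zorn_subset_nonempty
    {s : Set C | ∃ P : ThickIdeal C, P.carrier = s ∧ M ∉ s} (by
      intro c hc hchain ⟨s₀, hs₀⟩
      have key : ∀ s ∈ c, ∀ t ∈ c, ∃ P : ThickIdeal C,
          P.carrier ∈ c ∧ s ⊆ P.carrier ∧ t ⊆ P.carrier := by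
        intro s hs t ht
        obtain ⟨P, rfl, -⟩ := hc hs
        obtain ⟨P', rfl, -⟩ := hc ht
        rcases hchain.total hs ht with h | h
        · exact ⟨P', ht, h, subset_rfl⟩
        · exact ⟨P, hs, subset_rfl, h⟩
      have one : ∀ s ∈ c, ∃ P : ThickIdeal C, P.carrier = s := fun s hs =>
        (hc hs).imp fun _ h => h.1
      refine ⟨⋃₀ c, ⟨{
        carrier := ⋃₀ c
        zero_mem := fun A hA => ?_
        iso_closed := ?_
        shift_closed := ?_
        triangle_closed := ?_
        summand_closed := ?_
        tensor_right := ?_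
        tensor_left := ?_ }, rfl, ?_⟩, fun s hs => Set.subset_sUnion_of_mem hs⟩
      · obtain ⟨P, rfl⟩ := one _ hs₀
        exact ⟨_, hs₀, P.zero_mem A hA⟩
      · rintro A B e ⟨s, hs, hA⟩
        obtain ⟨P, rfl⟩ := one _ hs
        exact ⟨_, hs, P.iso_closed e hA⟩
      · rintro A n ⟨s, hs, hA⟩
        obtain ⟨P, rfl⟩ := one _ hs
        exact ⟨_, hs, P.shift_closed A n hA⟩
      · rintro T hT ⟨s, hs, h₁⟩ ⟨t, ht, h₂⟩
        obtain ⟨P, hP, hsP, htP⟩ := key s hs t ht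
        exact ⟨_, hP, P.triangle_closed T hT (hsP h₁) (htP h₂)⟩
      · rintro A B ⟨s, hs, hA⟩
        obtain ⟨P, rfl⟩ := one _ hs
        exact ⟨_, hs, P.summand_closed A B hA⟩
      · rintro A ⟨s, hs, hA⟩ B
        obtain ⟨P, rfl⟩ := one _ hs
        exact ⟨_, hs, P.tensor_right A hA B⟩
      · rintro A ⟨s, hs, hA⟩ B
        obtain ⟨P, rfl⟩ := one _ hs
        exact ⟨_, hs, P.tensor_left A hA B⟩
      · rintro ⟨s, hs, hMs⟩
        obtain ⟨-, -, h⟩ := hc hs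
        exact h hMs)
    _ ⟨ThickIdeal.bot hdual, rfl, hM⟩
  have mem_sup (I : ThickIdeal C) (hI : ¬ I.carrier ⊆ P.carrier) :
      M ∈ (ThickIdeal.sup hdual P I).carrier := by
    by_contra hMI
    refine hI fun A hA => ?_
    exact hmax ⟨_, rfl, hMI⟩
      (fun X hX => ThickSubcat.subset_closure _ (Or.inl hX))
      (ThickSubcat.subset_closure _ (Or.inr hA))
  refine ⟨P, ⟨fun h => hMP (h ▸ Set.mem_univ M), fun I J hIJ => ?_⟩, hMP⟩
  by_contra! h
  obtain ⟨N, i, r, hir⟩ := exists_retract_tensor hdual M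
  exact hMP (P.mem_of_retract i r hir (ThickIdeal.tensor_mem_of_mem_sup hdual hIJ
    (mem_sup I h.1) ((ThickIdeal.sup hdual P J).tensor_left _ (mem_sup J h.2) N)))

end Dualizable

end

/-- If every object of `K` is either left or right dualizable and
`K` has objects `A`, `B` with `A ⊗ B ≅ 0` but `B ⊗ A ≇ 0`, then not all prime
ideals of `K` are completely prime. -/
theorem one_sided_zero_implies_not_all_completelyPrime
    (hdual : ∀ A : C,
      (∃ B : C, Nonempty (ExactPairing A B)) ∨
        (∃ B : C, Nonempty (ExactPairing B A)))
    (A B : C) (hAB : IsZero (A ⊗ B)) (hBA : ¬ IsZero (B ⊗ A)) :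
    ¬ ∀ P : ThickIdeal C, P.IsPrime → P.IsCompletelyPrime := by
  intro h
  obtain ⟨P, hP, hBAP⟩ := exists_isPrime_notMem hdual hBA
  rcases (h P hP).2 A B (P.zero_mem _ hAB) with hA | hB
  · exact hBAP (P.tensor_left A hA B)
  · exact hBAP (P.tensor_right B hB A)
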